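/- (Strengthened Johnson–Lindenstrauss) Let N ≥ 2 and let X ⊆ ℝ^d be a set of N points. For any α ∈ (0, 1) and any integer m with 24·α^{−2}·log N ≤ m ≤ d, there exist a linear map φ : ℝ^d → ℝ^m satisfying ‖φ(x)‖₂ ≤ ‖x‖₂ for all x ∈ ℝ^d (i.e., φ is 1-Lipschitz) and a real number β > 0 such that (1 − α)·β·‖x − x'‖₂ ≤ ‖φ(x) − φ(x')‖₂ ≤ (1 + α)·β·‖x − x'‖₂ for all x, x' ∈ X; moreover, if m ≥ 10·log d then β ≥ (1/2)·√(m/d). -/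

import Mathlib

namespace JL
open MeasureTheory

/-- Gaussian integral with a diagonal quadratic form. -/
lemma lintegral_gauss {d : ℕ} (c : Fin d → ℝ) (hc : ∀ i, 0 < c i) :
    ∫⁻ y : EuclideanSpace ℝ (Fin d), ENNReal.ofReal (Real.exp (-∑ i, c i * (y i) ^ 2))
      = ENNReal.ofReal (∏ i, √(Real.pi / c i)) := by
  have h1 := (PiLp.volume_preserving_ofLp (Fin d)).lintegral_comp_emb
    (MeasurableEquiv.toLp 2 (Fin d → ℝ)).symm.measurableEmbedding
    (fun y : Fin d → ℝ => ENNReal.ofReal (Real.exp (-∑ i, c i * (y i) ^ 2)))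
  rw [h1]
  have h2 : ∀ y : Fin d → ℝ, Real.exp (-∑ i, c i * (y i) ^ 2)
      = ∏ i, Real.exp (-c i * (y i) ^ 2) := by
    intro y
    rw [← Real.exp_sum, ← Finset.sum_neg_distrib]
    simp
  simp_rw [h2]
  rw [← ofReal_integral_eq_lintegral_ofReal]
  · rw [integral_fintype_prod_volume_eq_prod (fun i x => Real.exp (-c i * x ^ 2))]
    simp_rw [integral_gaussian]
  · exact Integrable.fintype_prod (f := fun i x => Real.exp (-c i * x ^ 2))
      (fun i => integrable_exp_neg_mul_sq (hc i))
  · exact Filter.Eventually.of_forall fun y => Finset.prod_nonneg fun i _ => (Real.exp_pos _).le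

/-- the orthogonal group -/
noncomputable abbrev OG (d : ℕ) : Type :=
  unitary (EuclideanSpace ℝ (Fin d) →L[ℝ] EuclideanSpace ℝ (Fin d))

instance (d : ℕ) : ContinuousStar (EuclideanSpace ℝ (Fin d) →L[ℝ] EuclideanSpace ℝ (Fin d)) :=
  ⟨(ContinuousLinearMap.adjoint (𝕜 := ℝ) (E := EuclideanSpace ℝ (Fin d))
    (F := EuclideanSpace ℝ (Fin d))).continuous⟩

instance (d : ℕ) : IsTopologicalGroup (OG d) := inferInstance

noncomputable instance (d : ℕ) : MeasurableSpace (OG d) := borel _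
instance (d : ℕ) : BorelSpace (OG d) := ⟨rfl⟩

instance (d : ℕ) : CompactSpace (OG d) := by
  apply isCompact_iff_compactSpace.1
  have : ProperSpace (EuclideanSpace ℝ (Fin d) →L[ℝ] EuclideanSpace ℝ (Fin d)) :=
    FiniteDimensional.proper ℝ _
  apply Metric.isCompact_of_isClosed_isBounded
  · exact isClosed_unitary
  · refine (Metric.isBounded_closedBall (x := 0) (r := 1)).subset ?_
    intro u hu
    rw [mem_closedBall_zero_iff]
    refine ContinuousLinearMap.opNorm_le_bound _ zero_le_one fun x => ?_
    rw [one_mul]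
    exact (Unitary.norm_map ⟨u, hu⟩ x).le

instance (d : ℕ) : SecondCountableTopology (OG d) := by
  have : ProperSpace (EuclideanSpace ℝ (Fin d) →L[ℝ] EuclideanSpace ℝ (Fin d)) :=
    FiniteDimensional.proper ℝ _
  infer_instance

lemma cont_act {d : ℕ} : Continuous (fun p : OG d × EuclideanSpace ℝ (Fin d) =>
    ((p.1⁻¹ : OG d) : EuclideanSpace ℝ (Fin d) →L[ℝ] EuclideanSpace ℝ (Fin d)) p.2) := by
  have h : Continuous (fun p : OG d × EuclideanSpace ℝ (Fin d) =>
    ((p.1⁻¹ : OG d) : EuclideanSpace ℝ (Fin d) →L[ℝ] EuclideanSpace ℝ (Fin d))) :=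
    continuous_subtype_val.comp (continuous_inv.comp continuous_fst)
  exact h.clm_apply continuous_snd

noncomputable def μ (d : ℕ) : Measure (OG d) := Measure.haarMeasure ⊤

instance (d : ℕ) : (μ d).IsMulLeftInvariant := by unfold μ; infer_instance

instance (d : ℕ) : IsProbabilityMeasure (μ d) := ⟨by
  have := Measure.haarMeasure_self (K₀ := (⊤ : TopologicalSpace.PositiveCompacts (OG d)))
  simpa [μ] using this⟩

/-- bad event -/
def bad {d : ℕ} (w : Fin d → ℝ) (x : EuclideanSpace ℝ (Fin d)) : Set (OG d) :=
  {g | 0 ≤ ∑ i, w i * ((((g⁻¹ : OG d) : EuclideanSpace ℝ (Fin d) →L[ℝ]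
    EuclideanSpace ℝ (Fin d)) x) i) ^ 2}

lemma exists_rot {d : ℕ} (x y : EuclideanSpace ℝ (Fin d)) (hx : x ≠ 0) (hy : y ≠ 0) :
    ∃ (R : OG d) (k : ℝ), k ≠ 0 ∧
      y = k • (R : EuclideanSpace ℝ (Fin d) →L[ℝ] EuclideanSpace ℝ (Fin d)) x := by
  have hx' : ‖x‖ ≠ 0 := norm_ne_zero_iff.2 hx
  have hy' : ‖y‖ ≠ 0 := norm_ne_zero_iff.2 hy
  set z := (‖x‖ / ‖y‖) • y with hz
  have hn : ‖x‖ = ‖z‖ := by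
    rw [hz, norm_smul, norm_div, norm_norm, norm_norm]; field_simp
  refine ⟨Unitary.linearIsometryEquiv.symm (Submodule.reflection (ℝ ∙ (x - z))ᗮ), ‖y‖ / ‖x‖,
    div_ne_zero hy' hx', ?_⟩
  have := Submodule.reflection_sub hn
  rw [Unitary.coe_symm_linearIsometryEquiv_apply]
  change y = (‖y‖ / ‖x‖) • (Submodule.reflection (ℝ ∙ (x - z))ᗮ) x
  rw [this, hz, smul_smul]
  rw [div_mul_div_comm, mul_comm, div_self (by positivity), one_smul]

lemma bad_eq {d : ℕ} (w : Fin d → ℝ) (x y : EuclideanSpace ℝ (Fin d)) (hx : x ≠ 0) (hy : y ≠ 0) :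
    μ d (bad w y) = μ d (bad w x) := by
  obtain ⟨R, k, hk, rfl⟩ := exists_rot x y hx hy
  rw [← measure_preimage_mul (μ d) R⁻¹ (bad w x)]
  congr 1
  ext g
  simp only [bad, Set.mem_ofPred_eq, Set.mem_preimage, mul_inv_rev, inv_inv, map_smul,
    PiLp.smul_apply, smul_eq_mul, mul_pow, Submonoid.coe_mul, mul_apply_eq_comp]
  have : ∀ f : Fin d → ℝ, ∑ i, w i * (k ^ 2 * f i) = k ^ 2 * ∑ i, w i * f i := by
    intro f; rw [Finset.mul_sum]; exact Finset.sum_congr rfl fun i _ => by ring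
  rw [this]
  have hk2 : 0 < k ^ 2 := by positivity
  exact mul_nonneg_iff_of_pos_left hk2

lemma meas_bad {d : ℕ} (w : Fin d → ℝ) : ∀ y, MeasurableSet (bad w y) := by
  intro y
  have hc : Continuous fun g : OG d => ((g⁻¹ : OG d) : EuclideanSpace ℝ (Fin d) →L[ℝ]
      EuclideanSpace ℝ (Fin d)) y := by
    have h : Continuous (fun g : OG d => ((g⁻¹ : OG d) : EuclideanSpace ℝ (Fin d) →L[ℝ]
      EuclideanSpace ℝ (Fin d))) := continuous_subtype_val.comp continuous_inv
    exact h.clm_apply continuous_const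
  have hq : Continuous fun z : EuclideanSpace ℝ (Fin d) => ∑ i, w i * (z i) ^ 2 := by fun_prop
  exact (isClosed_le continuous_const (hq.comp hc)).measurableSet

lemma bad_bound {d : ℕ} (w : Fin d → ℝ) (hw : ∀ i, w i < 1)
    (x : EuclideanSpace ℝ (Fin d)) (hx : x ≠ 0) :
    μ d (bad w x) ≤ ENNReal.ofReal (∏ i, √(1 / (1 - w i))) := by
  have : Nontrivial (EuclideanSpace ℝ (Fin d)) := ⟨x, 0, hx⟩
  set F : EuclideanSpace ℝ (Fin d) → ENNReal := fun y =>
    ENNReal.ofReal (Real.exp (-∑ i, (1 - w i) * (y i) ^ 2)) with hF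
  set G : EuclideanSpace ℝ (Fin d) → ENNReal := fun y =>
    ENNReal.ofReal (Real.exp (-∑ i, 1 * (y i) ^ 2)) with hG
  have hFc : Continuous F := ENNReal.continuous_ofReal.comp (by fun_prop)
  have hGc : Continuous G := ENNReal.continuous_ofReal.comp (by fun_prop)
  have hGrot : ∀ (g : OG d) y, G ((g : EuclideanSpace ℝ (Fin d) →L[ℝ] _) y) = G y := by
    intro g y
    have : ∀ y : EuclideanSpace ℝ (Fin d), ∑ i, 1 * (y i) ^ 2 = ‖y‖ ^ 2 := by
      intro y; simp [EuclideanSpace.real_norm_sq_eq]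
    simp only [hG, this, Unitary.norm_map]
  have hmeas := meas_bad w
  have key : ∀ y, y ≠ 0 → μ d (bad w x) * G y ≤
      ∫⁻ g, F (((g⁻¹ : OG d) : EuclideanSpace ℝ (Fin d) →L[ℝ] _) y) ∂(μ d) := by
    intro y hy
    rw [← bad_eq w x y hx hy, mul_comm, ← lintegral_indicator_const (hmeas y)]
    refine lintegral_mono fun g => ?_
    by_cases hg : g ∈ bad w y
    · rw [Set.indicator_of_mem hg, ← hGrot g⁻¹ y]
      simp only [hF, hG]
      apply ENNReal.ofReal_le_ofReal
      apply Real.exp_le_exp.2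
      have h0 : 0 ≤ ∑ i, w i * ((((g⁻¹ : OG d) : EuclideanSpace ℝ (Fin d) →L[ℝ]
        EuclideanSpace ℝ (Fin d)) y) i) ^ 2 := hg
      simp only [sub_mul, Finset.sum_sub_distrib]
      linarith
    · rw [Set.indicator_of_notMem hg]; exact zero_le
  have h1 : ∫⁻ y, μ d (bad w x) * G y ≤
      ∫⁻ y, ∫⁻ g, F (((g⁻¹ : OG d) : EuclideanSpace ℝ (Fin d) →L[ℝ] _) y) ∂(μ d) := by
    apply lintegral_mono_ae
    have : ∀ᵐ y : EuclideanSpace ℝ (Fin d), y ≠ 0 := by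
      rw [ae_iff]; simp
    filter_upwards [this] with y hy using key y hy
  have hswap : ∫⁻ y, ∫⁻ g, F (((g⁻¹ : OG d) : EuclideanSpace ℝ (Fin d) →L[ℝ] _) y) ∂(μ d)
      = ∫⁻ g, ∫⁻ y, F (((g⁻¹ : OG d) : EuclideanSpace ℝ (Fin d) →L[ℝ] _) y) ∂volume ∂(μ d) := by
    apply lintegral_lintegral_swap
    apply Measurable.aemeasurable
    exact ((hFc.comp cont_act).comp continuous_swap).measurable
  have hin : ∀ g : OG d, ∫⁻ y, F (((g⁻¹ : OG d) : EuclideanSpace ℝ (Fin d) →L[ℝ] _) y)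
      = ∫⁻ y, F y := by
    intro g
    exact (Unitary.linearIsometryEquiv g⁻¹).measurePreserving.lintegral_comp hFc.measurable
  rw [hswap] at h1
  simp_rw [hin] at h1
  rw [lintegral_const, measure_univ, mul_one, lintegral_const_mul _ hGc.measurable,
    hF, hG, lintegral_gauss _ (fun i => sub_pos.2 (hw i)),
    lintegral_gauss (fun _ => 1) (fun _ => one_pos)] at h1
  have hpos : 0 < ∏ i : Fin d, √(Real.pi / 1) := Finset.prod_pos fun i _ => by positivity
  have he : ∏ i, √(Real.pi / (1 - w i)) = (∏ i, √(1 / (1 - w i))) * ∏ i : Fin d, √(Real.pi / 1) := by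
    rw [← Finset.prod_mul_distrib]
    refine Finset.prod_congr rfl fun i _ => ?_
    rw [← Real.sqrt_mul (by have := hw i; apply div_nonneg <;> linarith)]
    congr 1; ring
  rw [he, ENNReal.ofReal_mul (Finset.prod_nonneg fun i _ => Real.sqrt_nonneg _)] at h1
  exact (ENNReal.mul_le_mul_iff_left (ENNReal.ofReal_pos.2 hpos).ne' ENNReal.ofReal_ne_top).1 h1

/-- squared norm of the first `m` coordinates -/
noncomputable def q {d : ℕ} (m : ℕ) (x : EuclideanSpace ℝ (Fin d)) : ℝ :=
  ∑ i : Fin d, if (i : ℕ) < m then (x i) ^ 2 else 0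

noncomputable def W (d m : ℕ) (p b : ℝ) (i : Fin d) : ℝ :=
  (1 - 1 / b) / (1 - b * p) * ((if (i : ℕ) < m then 1 else 0) - b * p)

lemma sum_W {d m : ℕ} (p b : ℝ) (x : EuclideanSpace ℝ (Fin d)) :
    ∑ i, W d m p b i * (x i) ^ 2
      = (1 - 1 / b) / (1 - b * p) * (q m x - b * p * ‖x‖ ^ 2) := by
  rw [EuclideanSpace.real_norm_sq_eq, q, Finset.mul_sum, ← Finset.sum_sub_distrib, Finset.mul_sum]
  refine Finset.sum_congr rfl fun i _ => ?_
  unfold W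
  split_ifs <;> ring

lemma one_sub_W {d m : ℕ} (p b : ℝ) (hb : 0 < b) (hbp : b * p < 1) (i : Fin d) :
    1 - W d m p b i = if (i : ℕ) < m then 1 / b else (1 - p) / (1 - b * p) := by
  have h : 1 - b * p ≠ 0 := by linarith
  unfold W
  split_ifs
  · field_simp; ring
  · field_simp; ring

lemma prod_W {d m : ℕ} (hmd : m < d) (p b α : ℝ) (hp : p = m / d) (hb : 0 < b)
    (hbp : b * p < 1) (hlog : Real.log b + 1 - b ≤ -α ^ 2) :
    ∏ i, √(1 / (1 - W d m p b i)) ≤ Real.exp (-(m * α ^ 2 / 2)) := by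
  have hd : (0 : ℝ) < d := by exact_mod_cast (Nat.zero_le m).trans_lt hmd
  have hmd' : (m : ℝ) < d := by exact_mod_cast hmd
  have hp1 : p < 1 := by rw [hp, div_lt_one hd]; exact hmd'
  have hterm : ∀ i : Fin d, √(1 / (1 - W d m p b i)) ≤
      Real.exp (if (i : ℕ) < m then (b - 1 - α ^ 2) / 2 else -((b - 1) * p / (1 - p) / 2)) := by
    intro i
    rw [one_sub_W p b hb hbp]
    have hs : ∀ a c : ℝ, a ≤ Real.exp (2 * c) → √a ≤ Real.exp c := by
      intro a c h
      rw [Real.sqrt_le_left (Real.exp_pos _).le, ← Real.exp_nat_mul]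
      exact_mod_cast h
    split_ifs
    · apply hs
      rw [one_div_one_div, ← Real.log_le_iff_le_exp hb]
      linarith
    · apply hs
      rw [one_div_div]
      have h1 := Real.add_one_le_exp (2 * -((b - 1) * p / (1 - p) / 2))
      refine le_trans (le_of_eq ?_) h1
      have : 1 - p ≠ 0 := by linarith
      field_simp; ring
  refine (Finset.prod_le_prod (fun i _ => Real.sqrt_nonneg _) fun i _ => hterm i).trans ?_
  rw [← Real.exp_sum]
  apply Real.exp_le_exp.2
  rw [Fin.sum_univ_eq_sum_range (fun i => if i < m then (b - 1 - α ^ 2) / 2 else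
    -((b - 1) * p / (1 - p) / 2)) d, ← Nat.add_sub_cancel' hmd.le, Finset.sum_range_add]
  have e1 : ∑ i ∈ Finset.range m, (if i < m then (b - 1 - α ^ 2) / 2 else
      -((b - 1) * p / (1 - p) / 2)) = m * ((b - 1 - α ^ 2) / 2) := by
    rw [Finset.sum_congr rfl (fun i hi => if_pos (Finset.mem_range.1 hi))]; simp
  have e2 : ∑ i ∈ Finset.range (d - m), (if m + i < m then (b - 1 - α ^ 2) / 2 else
      -((b - 1) * p / (1 - p) / 2)) = (d - m : ℝ) * -((b - 1) * p / (1 - p) / 2) := by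
    simp [Nat.cast_sub hmd.le]
  rw [e1, e2]
  have h3 : p / (1 - p) = m / (d - m) := by
    have : (d : ℝ) - m ≠ 0 := by linarith
    have : 1 - p ≠ 0 := by linarith
    rw [div_eq_div_iff ‹_› ‹_›, hp]; field_simp
  have h4 : (d - m : ℝ) * -((b - 1) * p / (1 - p) / 2) = - (b - 1) * m / 2 := by
    have : (d : ℝ) - m ≠ 0 := by linarith
    rw [mul_div_assoc (b - 1), h3]; field_simp
  rw [h4]
  apply le_of_eq; ring

lemma W_bound {d m : ℕ} (hmd : m < d) (p b α : ℝ) (hp : p = m / d) (hb : 0 < b)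
    (hbp : b * p < 1) (hlog : Real.log b + 1 - b ≤ -α ^ 2)
    (x : EuclideanSpace ℝ (Fin d)) (hx : x ≠ 0) :
    μ d (bad (W d m p b) x) ≤ ENNReal.ofReal (Real.exp (-(m * α ^ 2 / 2))) := by
  refine (bad_bound _ (fun i => ?_) x hx).trans
    (ENNReal.ofReal_le_ofReal (prod_W hmd p b α hp hb hbp hlog))
  have hd : (0 : ℝ) < d := by exact_mod_cast (Nat.zero_le m).trans_lt hmd
  have hmd' : (m : ℝ) < d := by exact_mod_cast hmd
  have hp1 : p < 1 := by rw [hp, div_lt_one hd]; exact hmd'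
  rw [← sub_pos, one_sub_W p b hb hbp]
  split_ifs
  · positivity
  · apply div_pos <;> linarith

lemma q_le {d : ℕ} (m : ℕ) (x : EuclideanSpace ℝ (Fin d)) : q m x ≤ ‖x‖ ^ 2 := by
  rw [EuclideanSpace.real_norm_sq_eq, q]
  refine Finset.sum_le_sum fun i _ => ?_
  split_ifs
  · exact le_rfl
  · positivity

/-- the total bad event for a vector `u` -/
def Bad {d : ℕ} (m : ℕ) (p α : ℝ) (u : EuclideanSpace ℝ (Fin d)) : Set (OG d) :=
  {g | ¬ ((1 - α) ^ 2 * p * ‖u‖ ^ 2 ≤ q m (((g⁻¹ : OG d) : EuclideanSpace ℝ (Fin d) →L[ℝ]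
      EuclideanSpace ℝ (Fin d)) u) ∧
    q m (((g⁻¹ : OG d) : EuclideanSpace ℝ (Fin d) →L[ℝ]
      EuclideanSpace ℝ (Fin d)) u) ≤ (1 + α) ^ 2 * p * ‖u‖ ^ 2)}

lemma Bad_bound {d m : ℕ} (hmd : m < d) (p α : ℝ) (hp : p = m / d) (hα0 : 0 < α) (hα1 : α < 1)
    (u : EuclideanSpace ℝ (Fin d)) (hu : u ≠ 0) :
    μ d (Bad m p α u) ≤ 2 * ENNReal.ofReal (Real.exp (-(m * α ^ 2 / 2))) := by
  have hd : (0 : ℝ) < d := by exact_mod_cast (Nat.zero_le m).trans_lt hmd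
  have hmd' : (m : ℝ) < d := by exact_mod_cast hmd
  have hp0 : 0 ≤ p := by rw [hp]; positivity
  have hp1 : p < 1 := by rw [hp, div_lt_one hd]; exact hmd'
  have hb1 : 0 < (1 - α) ^ 2 := by apply pow_pos; linarith
  have hb1' : (1 - α) ^ 2 < 1 := by nlinarith
  have hb2 : 0 < (1 + α) ^ 2 := by positivity
  have hb2' : 1 < (1 + α) ^ 2 := by nlinarith
  have hbp1 : (1 - α) ^ 2 * p < 1 := by nlinarith
  have hl1 : Real.log ((1 - α) ^ 2) + 1 - (1 - α) ^ 2 ≤ -α ^ 2 := by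
    have := Real.log_le_sub_one_of_pos (show 0 < 1 - α by linarith)
    rw [Real.log_pow]; push_cast; nlinarith
  have hl2 : Real.log ((1 + α) ^ 2) + 1 - (1 + α) ^ 2 ≤ -α ^ 2 := by
    have := Real.log_le_sub_one_of_pos (show 0 < 1 + α by linarith)
    rw [Real.log_pow]; push_cast; nlinarith
  have k1 := W_bound hmd p _ α hp hb1 hbp1 hl1 u hu
  have s1 : ∀ g : OG d, q m (((g⁻¹ : OG d) : EuclideanSpace ℝ (Fin d) →L[ℝ]
      EuclideanSpace ℝ (Fin d)) u) < (1 - α) ^ 2 * p * ‖u‖ ^ 2 →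
      g ∈ bad (W d m p ((1 - α) ^ 2)) u := by
    intro g hg
    simp only [bad, Set.mem_ofPred_eq]
    rw [sum_W, Unitary.norm_map]
    apply mul_nonneg_of_nonpos_of_nonpos
    · apply div_nonpos_of_nonpos_of_nonneg
      · have := one_lt_one_div hb1 hb1'
        linarith
      · linarith
    · linarith
  rw [two_mul]
  by_cases hbp2 : (1 + α) ^ 2 * p < 1
  · have k2 := W_bound hmd p _ α hp hb2 hbp2 hl2 u hu
    refine (measure_mono ?_).trans ((measure_union_le _ _).trans (add_le_add k1 k2))
    intro g hg
    simp only [Bad, Set.mem_ofPred_eq, not_and_or, not_le] at hg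
    rcases hg with hg | hg
    · exact Or.inl (s1 g hg)
    · right
      simp only [bad, Set.mem_ofPred_eq]
      rw [sum_W, Unitary.norm_map]
      apply mul_nonneg
      · apply div_nonneg
        · have := (div_le_one hb2).2 hb2'.le
          linarith
        · linarith
      · linarith
  · refine (measure_mono ?_).trans (k1.trans le_self_add)
    intro g hg
    simp only [Bad, Set.mem_ofPred_eq, not_and_or, not_le] at hg
    rcases hg with hg | hg
    · exact s1 g hg
    · exfalso
      have h1 := q_le m (((g⁻¹ : OG d) : EuclideanSpace ℝ (Fin d) →L[ℝ]
        EuclideanSpace ℝ (Fin d)) u)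
      rw [Unitary.norm_map] at h1
      push Not at hbp2
      nlinarith [sq_nonneg ‖u‖]

lemma exists_good {d m N : ℕ} (hN : 2 ≤ N) (X : Finset (EuclideanSpace ℝ (Fin d)))
    (hX : X.card = N) (hmd : m < d) (p α : ℝ) (hp : p = m / d) (hα0 : 0 < α) (hα1 : α < 1)
    (hm1 : 24 * Real.log N / α ^ 2 ≤ (m : ℝ)) :
    ∃ g : OG d, ∀ x ∈ X, ∀ x' ∈ X, x ≠ x' → g ∉ Bad m p α (x - x') := by
  classical
  by_contra hcon
  push Not at hcon
  have hsub : (Set.univ : Set (OG d)) ⊆ ⋃ z ∈ X.offDiag, Bad m p α (z.1 - z.2) := by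
    intro g _
    obtain ⟨x, hx, x', hx', hne, hg⟩ := hcon g
    simp only [Set.mem_iUnion]
    exact ⟨(x, x'), Finset.mem_offDiag.2 ⟨hx, hx', hne⟩, hg⟩
  have hNpos : (0 : ℝ) < N := by positivity
  have hN2 : (2 : ℝ) ≤ N := by exact_mod_cast hN
  have hexp : Real.exp (-(m * α ^ 2 / 2)) ≤ ((N : ℝ) ^ 12)⁻¹ := by
    rw [div_le_iff₀ (by positivity)] at hm1
    have : ((N : ℝ) ^ 12)⁻¹ = Real.exp (-(12 * Real.log N)) := by
      rw [Real.exp_neg]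
      congr 1
      have := Real.exp_nat_mul (Real.log N) 12
      rw [Real.exp_log hNpos] at this
      rw [← this]; norm_num
    rw [this]
    apply Real.exp_le_exp.2
    linarith
  have h1 : μ d Set.univ ≤ ∑ z ∈ X.offDiag, 2 * ENNReal.ofReal (((N : ℝ) ^ 12)⁻¹) := by
    refine (measure_mono hsub).trans ((measure_biUnion_finset_le _ _).trans
      (Finset.sum_le_sum fun z hz => ?_))
    have hz' := (Finset.mem_offDiag.1 hz).2.2
    refine (Bad_bound hmd p α hp hα0 hα1 _ (sub_ne_zero.2 hz')).trans ?_
    gcongr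
  rw [measure_univ, Finset.sum_const, nsmul_eq_mul] at h1
  have h2 : ((X.offDiag.card : ENNReal) * (2 * ENNReal.ofReal (((N : ℝ) ^ 12)⁻¹)))
      = ENNReal.ofReal (X.offDiag.card * (2 * ((N : ℝ) ^ 12)⁻¹)) := by
    rw [ENNReal.ofReal_mul (by positivity), ENNReal.ofReal_mul (by positivity)]
    simp
  rw [h2, ENNReal.one_le_ofReal] at h1
  have hcard : (X.offDiag.card : ℝ) ≤ (N : ℝ) ^ 2 := by
    have : X.offDiag.card ≤ N ^ 2 := by
      rw [Finset.offDiag_card, hX, sq]; exact Nat.sub_le _ _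
    exact_mod_cast this
  have h3 : (N : ℝ) ^ 2 * (2 * ((N : ℝ) ^ 12)⁻¹) < 1 := by
    have : (2 : ℝ) * N ^ 2 < N ^ 12 := by
      have h10 : (2 : ℝ) ^ 10 ≤ (N : ℝ) ^ 10 := by gcongr
      have : (N : ℝ) ^ 12 = N ^ 10 * N ^ 2 := by ring
      rw [this]
      have : (0 : ℝ) < N ^ 2 := by positivity
      nlinarith
    rw [← mul_assoc, ← div_eq_mul_inv, div_lt_one (by positivity)]
    linarith
  have h4 : (X.offDiag.card : ℝ) * (2 * ((N : ℝ) ^ 12)⁻¹) ≤ N ^ 2 * (2 * ((N : ℝ) ^ 12)⁻¹) := by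
    gcongr
  linarith

/-- restriction to the first `m` coordinates -/
noncomputable def restr {d m : ℕ} (h : m ≤ d) :
    EuclideanSpace ℝ (Fin d) →ₗ[ℝ] EuclideanSpace ℝ (Fin m) where
  toFun x := WithLp.toLp 2 (fun j => x (Fin.castLE h j))
  map_add' x y := by ext j; simp
  map_smul' c x := by ext j; simp

lemma norm_restr {d m : ℕ} (h : m ≤ d) (x : EuclideanSpace ℝ (Fin d)) :
    ‖restr h x‖ ^ 2 = q m x := by
  obtain ⟨k, rfl⟩ := Nat.exists_eq_add_of_le h
  rw [EuclideanSpace.real_norm_sq_eq, q, Fin.sum_univ_add]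
  simp [restr]
  rfl

end JL

/-- **Strengthened Johnson–Lindenstrauss lemma.** For an `N`-point set
`X ⊆ ℝ^d` with `N ≥ 2`, any `α ∈ (0,1)`, and any integer `m` with
`24 α⁻² log N ≤ m ≤ d`, there are a 1-Lipschitz linear map `φ : ℝ^d → ℝ^m` and `β > 0`
with `(1-α)β‖x-x'‖ ≤ ‖φx - φx'‖ ≤ (1+α)β‖x-x'‖` for all `x, x' ∈ X`; moreover
`β ≥ (1/2)√(m/d)` whenever `m ≥ 10 log d`. -/
theorem strengthened_johnson_lindenstrauss
    (d N : ℕ) (hN : 2 ≤ N) (X : Finset (EuclideanSpace ℝ (Fin d))) (hX : X.card = N)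
    (α : ℝ) (hα0 : 0 < α) (hα1 : α < 1)
    (m : ℕ) (hm1 : 24 * Real.log N / α ^ 2 ≤ (m : ℝ)) (hm2 : m ≤ d) :
    ∃ (φ : EuclideanSpace ℝ (Fin d) →ₗ[ℝ] EuclideanSpace ℝ (Fin m)) (β : ℝ),
      0 < β ∧
      (∀ v : EuclideanSpace ℝ (Fin d), ‖φ v‖ ≤ ‖v‖) ∧
      (∀ x ∈ X, ∀ x' ∈ X,
        (1 - α) * β * ‖x - x'‖ ≤ ‖φ x - φ x'‖ ∧
        ‖φ x - φ x'‖ ≤ (1 + α) * β * ‖x - x'‖) ∧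
      (10 * Real.log d ≤ (m : ℝ) → (1 / 2) * Real.sqrt ((m : ℝ) / d) ≤ β) := by
  have hN2 : (2 : ℝ) ≤ N := by exact_mod_cast hN
  have hlogN : 0 < Real.log N := Real.log_pos (by linarith)
  have hm0 : (0 : ℝ) < m := lt_of_lt_of_le (by positivity) hm1
  rcases hm2.eq_or_lt with rfl | hmd
  · refine ⟨LinearMap.id, 1, one_pos, fun v => le_rfl, ?_, ?_⟩
    · intro x _ x' _
      have := norm_nonneg (x - x')
      simp only [LinearMap.id_apply]
      constructor <;> nlinarith
    · intro _
      rw [div_self hm0.ne', Real.sqrt_one]; norm_num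
  · have hmd' : (m : ℝ) < d := by exact_mod_cast hmd
    have hp0 : 0 < (m : ℝ) / d := div_pos hm0 (hm0.trans hmd')
    obtain ⟨g, hg⟩ := JL.exists_good hN X hX hmd _ α rfl hα0 hα1 hm1
    set A : EuclideanSpace ℝ (Fin d) →L[ℝ] EuclideanSpace ℝ (Fin d) := ((g⁻¹ : JL.OG d) :
      EuclideanSpace ℝ (Fin d) →L[ℝ] EuclideanSpace ℝ (Fin d)) with hA
    have hAn : ∀ v, ‖A v‖ = ‖v‖ := fun v => Unitary.norm_map g⁻¹ v
    refine ⟨(JL.restr hm2).comp (A : EuclideanSpace ℝ (Fin d) →ₗ[ℝ] EuclideanSpace ℝ (Fin d)),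
      √((m : ℝ) / d), Real.sqrt_pos.2 hp0, ?_, ?_, ?_⟩
    · intro v
      refine le_of_sq_le_sq ?_ (norm_nonneg _)
      change ‖JL.restr hm2 (A v)‖ ^ 2 ≤ _
      rw [JL.norm_restr, ← hAn v]
      exact JL.q_le _ _
    · intro x hx x' hx'
      rw [← map_sub]
      change _ ≤ ‖JL.restr hm2 (A (x - x'))‖ ∧ ‖JL.restr hm2 (A (x - x'))‖ ≤ _
      by_cases hne : x = x'
      · subst hne; simp
      have hgood := hg x hx x' hx' hne
      simp only [JL.Bad, Set.mem_ofPred_eq, not_not] at hgood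
      rw [← hA, ← JL.norm_restr hm2] at hgood
      have hsq := Real.sq_sqrt hp0.le
      constructor
      · refine le_of_sq_le_sq ?_ (norm_nonneg _)
        rw [mul_pow, mul_pow, hsq]
        exact hgood.1
      · refine le_of_sq_le_sq ?_ (by positivity)
        rw [mul_pow, mul_pow, hsq]
        exact hgood.2
    · intro _
      have := Real.sqrt_nonneg ((m : ℝ) / d)
      linarith
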